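/- arXiv:2201.04678 — 2 statements merged into one kernel-verified Lean document; each statement's English description precedes it below -/
import Mathlib

section
/- Let G and H be connected graphs, let M be a nonempty proper module of G, and let G' be the graph obtained from G by replacing G[M] with H. Suppose |M| = |V(H)| and the minimum number of paths in a partition of G[M] into paths equals the minimum number of paths in a partition of H into paths. If G has a Hamiltonian cycle, then G' has a Hamiltonian cycle. -/
open SimpleGraph Set

/-- `M` is a module of `G`: every vertex outside `M` is adjacent to all of `M`
or to none of `M`. -/
def SimpleGraph.IsModuleSet {V : Type*} (G : SimpleGraph V) (M : Set V) : Prop :=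
  ∀ v ∉ M, (∀ m ∈ M, G.Adj v m) ∨ (∀ m ∈ M, ¬ G.Adj v m)

/-- The graph obtained from `G` by replacing `G[M]` with `H`: its vertices are
`(V ∖ M) ⊕ V(H)`, with the edges of `G` outside `M`, the edges of `H`, and all
edges between `N_G(M) ∖ M` and `V(H)`. -/
def modularReplacement {V W : Type*} (G : SimpleGraph V) (M : Set V)
    (H : SimpleGraph W) : SimpleGraph ({v : V // v ∉ M} ⊕ W) :=
  SimpleGraph.fromRel (fun x y =>
    match x, y with
    | Sum.inl u, Sum.inl v => G.Adj u.1 v.1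
    | Sum.inl u, Sum.inr _ => ∃ m ∈ M, G.Adj u.1 m
    | Sum.inr _, Sum.inl _ => False
    | Sum.inr u, Sum.inr v => H.Adj u v)

section Invariants

variable {V : Type*} (G : SimpleGraph V)

/-- A dominating set. -/
def IsDomSet (D : Set V) : Prop := ∀ v ∉ D, ∃ u ∈ D, G.Adj v u

/-- A minimum dominating set. -/
def IsMinDomSet (D : Set V) : Prop :=
  IsDomSet G D ∧ ∀ D', IsDomSet G D' → D.ncard ≤ D'.ncard

/-- The domination number. -/
noncomputable def domNum : ℕ := sInf {n | ∃ D, IsDomSet G D ∧ D.ncard = n}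

/-- A vertex cover. -/
def IsVCover (C : Set V) : Prop := ∀ ⦃u v⦄, G.Adj u v → u ∈ C ∨ v ∈ C

/-- A minimum vertex cover. -/
def IsMinVCover (C : Set V) : Prop :=
  IsVCover G C ∧ ∀ C', IsVCover G C' → C.ncard ≤ C'.ncard

/-- The vertex cover number. -/
noncomputable def vcNum : ℕ := sInf {n | ∃ C, IsVCover G C ∧ C.ncard = n}

/-- A connected vertex cover. -/
def IsCVCover (C : Set V) : Prop := IsVCover G C ∧ (G.induce C).Connected

/-- A minimum connected vertex cover. -/
def IsMinCVCover (C : Set V) : Prop :=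
  IsCVCover G C ∧ ∀ C', IsCVCover G C' → C.ncard ≤ C'.ncard

/-- The connected vertex cover number. -/
noncomputable def cvcNum : ℕ := sInf {n | ∃ C, IsCVCover G C ∧ C.ncard = n}

/-- A feedback vertex set: its removal leaves an acyclic graph. -/
def IsFVS (S : Set V) : Prop := (G.induce Sᶜ).IsAcyclic

/-- A minimum feedback vertex set. -/
def IsMinFVS (S : Set V) : Prop :=
  IsFVS G S ∧ ∀ S', IsFVS G S' → S.ncard ≤ S'.ncard

/-- The feedback vertex set number. -/
noncomputable def fvsNum : ℕ := sInf {n | ∃ S, IsFVS G S ∧ S.ncard = n}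

/-- An odd cycle transversal: its removal leaves a bipartite graph. -/
def IsOCT (S : Set V) : Prop := (G.induce Sᶜ).Colorable 2

/-- A minimum odd cycle transversal. -/
def IsMinOCT (S : Set V) : Prop :=
  IsOCT G S ∧ ∀ S', IsOCT G S' → S.ncard ≤ S'.ncard

/-- The odd cycle transversal number. -/
noncomputable def octNum : ℕ := sInf {n | ∃ S, IsOCT G S ∧ S.ncard = n}

/-- An independent set: pairwise non-adjacent vertices. -/
def IsIndepSet' (I : Set V) : Prop := I.Pairwise (fun u v => ¬ G.Adj u v)

/-- A partition of `G` into `k` (vertex-disjoint) paths covering all vertices. -/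
def IsPathPartition (k : ℕ) (P : Fin k → (u : V) × (v : V) × G.Walk u v) : Prop :=
  (∀ i, (P i).2.2.IsPath) ∧
  (∀ i j, i ≠ j → ∀ x, x ∈ (P i).2.2.support → x ∉ (P j).2.2.support) ∧
  (∀ x : V, ∃ i, x ∈ (P i).2.2.support)

/-- The minimum number of paths in a partition of `G` into paths. -/
noncomputable def pathPartitionNum : ℕ :=
  sInf {k | ∃ P : Fin k → (u : V) × (v : V) × G.Walk u v, IsPathPartition G k P}

/-- `G` has a Hamiltonian cycle. -/
def HasHamCycle : Prop := ∃ (v : V) (p : G.Walk v v), p.IsCycle ∧ ∀ u : V, u ∈ p.support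

/-- The number of vertices of a longest induced path of `G`. -/
noncomputable def lipNum : ℕ :=
  sSup {n | ∃ S : Set V, Nonempty (G.induce S ≃g pathGraph n)}

/-- `X` is an induced matching with `k` edges: `X` has `2k` vertices and the
subgraph induced by `X` is `1`-regular. -/
def IsInducedMatching (X : Set V) (k : ℕ) : Prop :=
  X.ncard = 2 * k ∧ ∀ v ∈ X, ∃! u, u ∈ X ∧ G.Adj v u

/-- The maximum number of edges of an induced matching of `G`. -/
noncomputable def imNum : ℕ := sSup {k | ∃ X, IsInducedMatching G X k}

/-- An independent triangle packing with `k` triangles: pairwise disjoint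
triangles with no edges of `G` between different triangles. -/
def IsIndepTrianglePacking (k : ℕ) (f : Fin k → Set V) : Prop :=
  (∀ i, ∃ a b c : V, f i = {a, b, c} ∧ G.Adj a b ∧ G.Adj a c ∧ G.Adj b c) ∧
  (∀ i j, i ≠ j → ∀ u ∈ f i, ∀ v ∈ f j, u ≠ v ∧ ¬ G.Adj u v)

/-- The maximum number of triangles in an independent triangle packing of `G`. -/
noncomputable def itpNum : ℕ :=
  sSup {k | ∃ f : Fin k → Set V, IsIndepTrianglePacking G k f}

/-- `C` is the vertex set of an induced cycle of `G`. -/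
def IsCycleSet (C : Set V) : Prop :=
  3 ≤ C.ncard ∧ (G.induce C).Connected ∧ ∀ v ∈ C, {u | u ∈ C ∧ G.Adj v u}.ncard = 2

/-- An independent cycle packing with `k` cycles: pairwise disjoint induced
cycles with no edges of `G` between different cycles. -/
def IsIndepCyclePacking (k : ℕ) (f : Fin k → Set V) : Prop :=
  (∀ i, IsCycleSet G (f i)) ∧
  (∀ i j, i ≠ j → ∀ u ∈ f i, ∀ v ∈ f j, u ≠ v ∧ ¬ G.Adj u v)

/-- The maximum number of cycles in an independent cycle packing of `G`. -/
noncomputable def icpNum : ℕ :=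
  sSup {k | ∃ f : Fin k → Set V, IsIndepCyclePacking G k f}

end Invariants

/-- A list of nonempty paths of `G`, given by their vertex lists, partitioning the vertices. -/
structure IsPathListPartition {V : Type*} (G : SimpleGraph V) (L : List (List V)) : Prop where
  ne_nil : ∀ B ∈ L, B ≠ []
  isChain : ∀ B ∈ L, B.IsChain G.Adj
  nodup : L.flatten.Nodup
  mem : ∀ x, x ∈ L.flatten

theorem IsPathPartition.exists_isPathListPartition {V : Type*} {G : SimpleGraph V} {k : ℕ}
    {P : Fin k → (u : V) × (v : V) × G.Walk u v} (hP : IsPathPartition G k P) :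
    ∃ L : List (List V), L.length = k ∧ IsPathListPartition G L := by
  obtain ⟨h1, h2, h3⟩ := hP
  refine ⟨List.ofFn fun i => (P i).2.2.support, by simp, ?_, ?_, ?_, ?_⟩
  · simp
  · simp only [List.mem_ofFn]
    rintro _ ⟨i, rfl⟩
    exact (P i).2.2.isChain_adj_support
  · rw [List.nodup_flatten]
    refine ⟨?_, ?_⟩
    · simp only [List.mem_ofFn]
      rintro _ ⟨i, rfl⟩
      exact (h1 i).support_nodup
    · rw [List.pairwise_ofFn]
      exact fun i j hij x hx hx' => h2 i j hij.ne x hx hx'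
  · intro x
    obtain ⟨i, hi⟩ := h3 x
    exact List.mem_flatten.2 ⟨_, List.mem_ofFn.2 ⟨i, rfl⟩, hi⟩

theorem IsPathListPartition.exists_isPathPartition {V : Type*} {G : SimpleGraph V}
    {L : List (List V)} (hL : IsPathListPartition G L) :
    ∃ P : Fin L.length → (u : V) × (v : V) × G.Walk u v, IsPathPartition G L.length P := by
  have hnd := List.nodup_flatten.1 hL.nodup
  refine ⟨fun i => ⟨_, _, Walk.ofSupport (L.get i) (hL.ne_nil _ (L.get_mem i))
    (hL.isChain _ (L.get_mem i))⟩, fun i => ?_, fun i j hij x hx hx' => ?_, fun x => ?_⟩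
  · rw [Walk.isPath_def, Walk.support_ofSupport]
    exact hnd.1 _ (L.get_mem i)
  · rw [Walk.support_ofSupport] at hx hx'
    rcases lt_or_gt_of_ne hij with h | h
    · exact List.pairwise_iff_get.1 hnd.2 i j h hx hx'
    · exact List.pairwise_iff_get.1 hnd.2 j i h hx' hx
  · obtain ⟨B, hB, hx⟩ := List.mem_flatten.1 (hL.mem x)
    obtain ⟨i, rfl⟩ := List.mem_iff_get.1 hB
    exact ⟨i, by rwa [Walk.support_ofSupport]⟩

theorem IsPathListPartition.pathPartitionNum_le {V : Type*} {G : SimpleGraph V}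
    {L : List (List V)} (hL : IsPathListPartition G L) : pathPartitionNum G ≤ L.length :=
  Nat.sInf_le hL.exists_isPathPartition

theorem isPathListPartition_singletons {V : Type*} [Fintype V] (G : SimpleGraph V) :
    IsPathListPartition G ((Finset.univ : Finset V).toList.map fun x => [x]) where
  ne_nil := by simp
  isChain := by simp
  nodup := by simpa [← List.flatMap_def] using Finset.nodup_toList _
  mem := by simp [← List.flatMap_def]

theorem exists_isPathListPartition_length_eq_pathPartitionNum {V : Type*} [Fintype V]
    (G : SimpleGraph V) :
    ∃ L : List (List V), L.length = pathPartitionNum G ∧ IsPathListPartition G L := by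
  obtain ⟨P, hP⟩ := Nat.sInf_mem
    (s := {k | ∃ P : Fin k → (u : V) × (v : V) × G.Walk u v, IsPathPartition G k P})
    ⟨_, (isPathListPartition_singletons G).exists_isPathPartition⟩
  exact hP.exists_isPathListPartition

/-- If some block of a list of chains has at least two elements, it can be split. -/
theorem List.exists_split_chain {α : Type*} {R : α → α → Prop} (L : List (List α))
    (hne : ∀ B ∈ L, B ≠ []) (hR : ∀ B ∈ L, B.IsChain R) (hlt : L.length < L.flatten.length) :
    ∃ L' : List (List α), L'.length = L.length + 1 ∧ L'.flatten = L.flatten ∧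
      (∀ B ∈ L', B ≠ []) ∧ ∀ B ∈ L', B.IsChain R := by
  induction L with
  | nil => simp at hlt
  | cons B L ih =>
    simp only [List.forall_mem_cons] at hne hR
    match B with
    | [] => exact absurd rfl hne.1
    | [x] =>
      obtain ⟨L', h1, h2, h3, h4⟩ := ih hne.2 hR.2 (by simp at hlt ⊢; omega)
      exact ⟨[x] :: L', by simp [h1], by simp [h2], by simpa using h3, by simpa using h4⟩
    | x :: y :: t =>
      exact ⟨[x] :: (y :: t) :: L, by simp, by simp, by simpa using hne.2,
        by simpa using ⟨hR.1.of_cons, hR.2⟩⟩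

theorem exists_isPathListPartition_length_eq {V : Type*} [Fintype V] (G : SimpleGraph V)
    {n : ℕ} (hn : pathPartitionNum G ≤ n) (hn' : n ≤ Fintype.card V) :
    ∃ L : List (List V), L.length = n ∧ IsPathListPartition G L := by
  classical
  induction n, hn using Nat.le_induction with
  | base => exact exists_isPathListPartition_length_eq_pathPartitionNum G
  | succ n _ ih =>
    obtain ⟨L, rfl, hL⟩ := ih (by omega)
    have hlen : Fintype.card V ≤ L.flatten.length := by
      rw [← Finset.card_univ, ← Finset.eq_univ_of_forall fun x => List.mem_toFinset.2 (hL.mem x)]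
      exact List.toFinset_card_le _
    obtain ⟨L', h1, h2, h3, h4⟩ := L.exists_split_chain hL.ne_nil hL.isChain (by omega)
    exact ⟨L', h1, h3, h4, h2 ▸ hL.nodup, h2 ▸ hL.mem⟩

theorem hasHamCycle_of_list {V : Type*} {G : SimpleGraph V} {v : V} {t : List V}
    (hc : (v :: t).IsChain G.Adj) (hlast : (v :: t).getLast (List.cons_ne_nil v t) = v)
    (hnd : t.Nodup) (hlen : 3 ≤ t.length) (hmem : ∀ u, u ∈ t) : HasHamCycle G := by
  obtain ⟨p, hp⟩ : ∃ p : G.Walk v v, p.support = v :: t :=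
    ⟨(Walk.ofSupport (v :: t) (List.cons_ne_nil v t) hc).copy rfl hlast,
      (Walk.support_copy _ _ _).trans (Walk.support_ofSupport _ hc)⟩
  have hplen : p.length = t.length := by simpa [hp] using p.length_support.symm
  refine ⟨v, p, Walk.isCycle_iff_isPath_tail_and_le_length.2 ⟨?_, by omega⟩, by simp [hp, hmem]⟩
  rw [Walk.isPath_def, Walk.support_tail_of_not_nil, hp]
  · exact hnd
  · rw [← Walk.length_eq_zero_iff]
    omega

theorem List.nodup_of_filterMap_getLeft_getRight {α β : Type*} {t : List (α ⊕ β)}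
    (hl : (t.filterMap Sum.getLeft?).Nodup) (hr : (t.filterMap Sum.getRight?).Nodup) :
    t.Nodup := by
  induction t with
  | nil => simp
  | cons a t ih => cases a <;> simp_all [List.filterMap_cons]

section Replacement

variable {V W : Type*} {G : SimpleGraph V} {M : Set V} {H : SimpleGraph W}

@[simp]
theorem modularReplacement_adj_inl_inl {u v : {v : V // v ∉ M}} :
    (modularReplacement G M H).Adj (Sum.inl u) (Sum.inl v) ↔ G.Adj u.1 v.1 := by
  simp only [modularReplacement, fromRel_adj, G.adj_comm v.1, or_self, ne_eq, Sum.inl.injEq,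
    and_iff_right_iff_imp]
  rintro h rfl
  exact G.loopless.irrefl _ h

@[simp]
theorem modularReplacement_adj_inr_inr {u v : W} :
    (modularReplacement G M H).Adj (Sum.inr u) (Sum.inr v) ↔ H.Adj u v := by
  simp only [modularReplacement, fromRel_adj, H.adj_comm v, or_self, ne_eq, Sum.inr.injEq,
    and_iff_right_iff_imp]
  rintro h rfl
  exact H.loopless.irrefl _ h

theorem modularReplacement_adj_inl_inr {u : {v : V // v ∉ M}} {w : W} {m : V} (hm : m ∈ M)
    (h : G.Adj u.1 m) : (modularReplacement G M H).Adj (Sum.inl u) (Sum.inr w) := by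
  simpa [modularReplacement] using ⟨m, hm, h⟩

/-- The maximal segments of a walk inside `M` form a list of paths of `G[M]`, and replacing them
by any list of equally many paths of `H` gives a walk in the modular replacement. -/
theorem exists_segments_replacement [DecidablePred (· ∈ M)] (l : List V) (hl : l.IsChain G.Adj)
    {z : V} (hz : z ∉ M) (hlast : l.getLast? = some z) :
    ∃ L : List (List M), (∀ B ∈ L, B ≠ []) ∧ (∀ B ∈ L, B.IsChain (G.induce M).Adj) ∧
      L.flatten.map Subtype.val = l.filter (· ∈ M) ∧
      ∀ K : List (List W), K.length = L.length → (∀ B ∈ K, B ≠ []) →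
        (∀ B ∈ K, B.IsChain H.Adj) →
        ∃ l' : List ({v : V // v ∉ M} ⊕ W), l'.IsChain (modularReplacement G M H).Adj ∧
          l'.getLast? = some (Sum.inl ⟨z, hz⟩) ∧
          (l'.filterMap Sum.getLeft?).map Subtype.val = l.filter (· ∉ M) ∧
          l'.filterMap Sum.getRight? = K.flatten ∧
          (∀ a (ha : a ∉ M), l.head? = some a → l'.head? = some (Sum.inl ⟨a, ha⟩)) ∧
          (∀ a ∈ M, l.head? = some a → ∃ w, l'.head? = some (Sum.inr w)) := by
  induction l with
  | nil => simp at hlast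
  | cons a l ih =>
    cases l with
    | nil =>
      obtain rfl : a = z := by simpa using hlast
      refine ⟨[], by simp, by simp, by simp [hz], fun K hK _ _ => ?_⟩
      obtain rfl : K = [] := by simpa using hK
      refine ⟨[Sum.inl ⟨a, hz⟩], by simp, by simp, by simp [hz], by simp, ?_, ?_⟩
      · rintro _ _ ⟨⟩
        simp
      · rintro _ h ⟨⟩
        exact absurd h hz
    | cons b t =>
      obtain ⟨hab, hl⟩ := List.isChain_cons_cons.1 hl
      obtain ⟨L, hne, hch, hfl, hrep⟩ := ih hl (by simpa using hlast)
      by_cases ha : a ∈ M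
      · by_cases hb : b ∈ M
        · cases L with
          | nil => simp [hb] at hfl
          | cons B L =>
          cases B with
          | nil => simp at hne
          | cons c B =>
          obtain ⟨rfl, hfl⟩ : c.1 = b ∧ _ := by simpa [hb] using hfl
          refine ⟨(⟨a, ha⟩ :: c :: B) :: L, by simpa using hne, ?_, ?_, fun K hK h1 h2 => ?_⟩
          · simpa [hab] using hch
          · simpa [ha, hb] using hfl
          · obtain ⟨l', g1, g2, g3, g4, g5, g6⟩ := hrep K (by simpa using hK) h1 h2
            refine ⟨l', g1, g2, by simpa [ha] using g3, g4, ?_, ?_⟩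
            · rintro _ h ⟨⟩
              exact absurd ha h
            · rintro _ h ⟨⟩
              exact g6 c.1 hb rfl
        · refine ⟨[⟨a, ha⟩] :: L, by simpa using hne, by simpa using hch, by simpa [ha] using hfl,
            fun K hK h1 h2 => ?_⟩
          cases K with
          | nil => simp at hK
          | cons C K =>
          simp only [List.forall_mem_cons] at h1 h2
          obtain ⟨l', g1, g2, g3, g4, g5, g6⟩ := hrep K (by simpa using hK) h1.2 h2.2
          have hhead := g5 b hb rfl
          refine ⟨C.map Sum.inr ++ l', ?_, ?_, ?_, ?_, ?_, ?_⟩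
          · rw [List.isChain_append]
            refine ⟨?_, g1, ?_⟩
            · rw [List.isChain_map]
              simpa using h2.1
            · intro x hx y hy
              obtain rfl : y = Sum.inl ⟨b, hb⟩ := by simpa [hhead, eq_comm] using hy
              obtain ⟨w, hw, rfl⟩ : ∃ w, C.getLast? = some w ∧ Sum.inr w = x := by simpa using hx
              exact (modularReplacement_adj_inl_inr ha hab.symm).symm
          · simp [List.getLast?_append, g2]
          · simpa [List.filterMap_map, Function.comp_def, ha] using g3
          · simp [List.filterMap_map, Function.comp_def, g4]
          · rintro _ h ⟨⟩
            exact absurd ha h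
          · rintro _ h ⟨⟩
            obtain ⟨w, C, rfl⟩ := List.exists_cons_of_ne_nil h1.1
            simp
      · refine ⟨L, hne, hch, by simpa [ha] using hfl, fun K hK h1 h2 => ?_⟩
        obtain ⟨l', g1, g2, g3, g4, g5, g6⟩ := hrep K hK h1 h2
        refine ⟨Sum.inl ⟨a, ha⟩ :: l', ?_, ?_, ?_, by simpa [List.filterMap_cons] using g4, ?_, ?_⟩
        · rw [List.isChain_cons]
          refine ⟨fun y hy => ?_, g1⟩
          by_cases hb : b ∈ M
          · obtain ⟨w, hw⟩ := g6 b hb rfl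
            obtain rfl : y = Sum.inr w := by simpa [hw, eq_comm] using hy
            exact modularReplacement_adj_inl_inr hb hab
          · obtain rfl : y = Sum.inl ⟨b, hb⟩ := by simpa [g5 b hb rfl, eq_comm] using hy
            simpa using hab
        · simp [List.getLast?_cons, g2]
        · simpa [ha] using g3
        · rintro _ h ⟨⟩
          simp
        · rintro _ h ⟨⟩
          exact absurd h ha

end Replacement

theorem stmt15 {V W : Type*} [Fintype V] [Fintype W]
    (G : SimpleGraph V) (H : SimpleGraph W) (M : Set V)
    (hG : G.Connected) (hH : H.Connected)
    (hMod : G.IsModuleSet M) (hne : M.Nonempty) (hproper : M ≠ Set.univ)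
    (hcard : M.ncard = Fintype.card W)
    (hpip : pathPartitionNum (G.induce M) = pathPartitionNum H)
    (hham : HasHamCycle G) :
    HasHamCycle (modularReplacement G M H) := by
  classical
  obtain ⟨v, hv⟩ := (Set.ne_univ_iff_exists_notMem M).1 hproper
  obtain ⟨p, hp, hpm⟩ : ∃ p : G.Walk v v, p.IsCycle ∧ ∀ u, u ∈ p.support := by
    obtain ⟨u, p, hp, hpm⟩ := hham
    exact ⟨p.rotate v (hpm v), hp.rotate _, fun x => by simpa using hpm x⟩
  have hsupp := p.cons_tail_support
  set t := p.support.tail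
  have htnd : t.Nodup := hp.support_nodup
  have htm : ∀ u, u ∈ t := fun u => by
    by_cases h : u = v
    · exact h ▸ Walk.end_mem_tail_support hp.not_nil
    · simpa [← hsupp, h] using hpm u
  have htlen : 3 ≤ t.length := by simpa [t] using hp.three_le_length
  have hlast : (v :: t).getLast? = some v := by
    rw [hsupp, List.getLast?_eq_getLast_of_ne_nil p.support_ne_nil, p.getLast_support]
  obtain ⟨L, hne, hch, hfl, hrep⟩ := exists_segments_replacement (H := H) (M := M) (v :: t)
    (hsupp ▸ p.isChain_adj_support) hv hlast
  have hfl' : L.flatten.map Subtype.val = t.filter (· ∈ M) := by simpa [hv] using hfl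
  have hL : IsPathListPartition (G.induce M) L := by
    refine ⟨hne, hch, List.Nodup.of_map Subtype.val (hfl' ▸ htnd.filter _), fun x => ?_⟩
    rw [← List.mem_map_of_injective Subtype.val_injective, hfl']
    simp [htm]
  have hlen : L.length ≤ Fintype.card W := by
    calc L.length ≤ L.flatten.length := by
          rw [List.length_flatten, ← List.length_map (f := List.length)]
          refine List.length_le_sum_of_one_le _ fun n hn => ?_
          obtain ⟨B, hB, rfl⟩ := List.mem_map.1 hn
          exact List.length_pos_of_ne_nil (hne B hB)
      _ ≤ Fintype.card M := hL.nodup.length_le_card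
      _ = Fintype.card W := by rw [← hcard, ← Nat.card_coe_set_eq, Nat.card_eq_fintype_card]
  obtain ⟨K, hKlen, hK⟩ := exists_isPathListPartition_length_eq H
    (hpip ▸ hL.pathPartitionNum_le) hlen
  obtain ⟨l', g1, g2, g3, g4, g5, -⟩ := hrep K hKlen hK.ne_nil hK.isChain
  obtain ⟨t', rfl⟩ : ∃ t', l' = Sum.inl ⟨v, hv⟩ :: t' :=
    List.head?_eq_some_iff.1 (g5 v hv rfl)
  have hleft : (t'.filterMap Sum.getLeft?).map Subtype.val = t.filter (· ∉ M) := by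
    simpa [hv] using g3
  have hright : t'.filterMap Sum.getRight? = K.flatten := by
    simpa [List.filterMap_cons] using g4
  have hmem : ∀ x, x ∈ t' := by
    rintro (⟨x, hx⟩ | w)
    · have : x ∈ (t'.filterMap Sum.getLeft?).map Subtype.val := by simp [hleft, htm, hx]
      simpa [hx] using this
    · have : w ∈ t'.filterMap Sum.getRight? := hright ▸ hK.mem w
      simpa using this
  refine hasHamCycle_of_list g1 (List.getLast_of_getLast?_eq_some g2)
    (List.nodup_of_filterMap_getLeft_getRight
      (List.Nodup.of_map Subtype.val (hleft ▸ htnd.filter _)) (hright ▸ hK.nodup)) ?_ hmem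
  calc 3 ≤ t.length := htlen
    _ ≤ Fintype.card V := htnd.length_le_card
    _ = Fintype.card ({v : V // v ∉ M} ⊕ W) := by
      rw [Fintype.card_sum, ← hcard, ← Nat.card_eq_fintype_card, ← Nat.card_eq_fintype_card,
        ← Set.ncard_add_ncard_compl M, add_comm]
      rfl
    _ ≤ t'.length := by
      rw [← Finset.card_univ, ← Finset.eq_univ_of_forall fun x => List.mem_toFinset.2 (hmem x)]
      exact List.toFinset_card_le _
end

section
/- Let G and H be connected graphs, let M be a nonempty proper module of G, and let G' be the graph obtained from G by replacing G[M] with H. If |M| = |V(H)|, the minimum vertex covers of G[M] and of H have the same size, the maximum induced matchings of G[M] and of H have the same number of edges, and the maximum independent cycle packings of G[M] and of H have the same number of cycles, then the maximum number of cycles in an independent cycle packing of G is at most the maximum number of cycles in an independent cycle packing of G'. -/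
open SimpleGraph Set

namespace modularReplacement

variable {V W : Type*} {G : SimpleGraph V} {M : Set V} {H : SimpleGraph W}

@[simp]
theorem adj_inl_inl {u v : {v : V // v ∉ M}} :
    (modularReplacement G M H).Adj (Sum.inl u) (Sum.inl v) ↔ G.Adj u.1 v.1 := by
  simp only [modularReplacement, SimpleGraph.fromRel_adj, ne_eq, Sum.inl.injEq, G.adj_comm v.1 u.1,
    or_self, and_iff_right_iff_imp]
  rintro h rfl
  exact h.ne rfl

@[simp]
theorem adj_inl_inr {u : {v : V // v ∉ M}} {w : W} :
    (modularReplacement G M H).Adj (Sum.inl u) (Sum.inr w) ↔ ∃ m ∈ M, G.Adj u.1 m := by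
  simp [modularReplacement]

@[simp]
theorem adj_inr_inl {u : {v : V // v ∉ M}} {w : W} :
    (modularReplacement G M H).Adj (Sum.inr w) (Sum.inl u) ↔ ∃ m ∈ M, G.Adj u.1 m := by
  simp [modularReplacement]

@[simp]
theorem adj_inr_inr {w x : W} :
    (modularReplacement G M H).Adj (Sum.inr w) (Sum.inr x) ↔ H.Adj w x := by
  simp only [modularReplacement, SimpleGraph.fromRel_adj, ne_eq, Sum.inr.injEq, H.adj_comm x w,
    or_self, and_iff_right_iff_imp]
  rintro h rfl
  exact h.ne rfl

variable (G M H)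

/-- The part of `G` outside the module embeds into the replacement. -/
def inlEmbedding :
    G.comap (Subtype.val : {v : V // v ∉ M} → V) ↪g modularReplacement G M H where
  toFun := Sum.inl
  inj' := Sum.inl_injective
  map_rel_iff' := adj_inl_inl

/-- The replacing graph embeds into the replacement. -/
def inrEmbedding : H ↪g modularReplacement G M H where
  toFun := Sum.inr
  inj' := Sum.inr_injective
  map_rel_iff' := adj_inr_inr

open Classical in
/-- Replacing a module with at most one vertex does not lose any adjacency. -/
noncomputable def embeddingOfSubsingleton (hM : M.Subsingleton) (w : W) :
    G ↪g modularReplacement G M H where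
  toFun v := if h : v ∈ M then Sum.inr w else Sum.inl ⟨v, h⟩
  inj' u v h := by
    by_cases hu : u ∈ M <;> by_cases hv : v ∈ M <;> simp [hu, hv] at h
    · exact hM hu hv
    · exact h
  map_rel_iff' {u v} := by
    have key : ∀ {x y}, y ∈ M → ((∃ m ∈ M, G.Adj x m) ↔ G.Adj x y) := fun {x y} hy =>
      ⟨fun ⟨m, hm, h⟩ => hM hm hy ▸ h, fun h => ⟨y, hy, h⟩⟩
    change (modularReplacement G M H).Adj (dite _ _ _) (dite _ _ _) ↔ _
    by_cases hu : u ∈ M <;> by_cases hv : v ∈ M <;> simp only [hu, hv, dite_true, dite_false,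
      adj_inl_inl, adj_inl_inr, adj_inr_inl, SimpleGraph.irrefl, false_iff]
    · exact hM hu hv ▸ G.loopless.irrefl u
    · rw [key hu, G.adj_comm]
    · rw [key hv]

end modularReplacement

section CyclePacking

variable {V V' : Type*} {G : SimpleGraph V} {G' : SimpleGraph V'}

theorem isCycleSet_image_iff (φ : G ↪g G') {C : Set V} :
    IsCycleSet G' (φ '' C) ↔ IsCycleSet G C := by
  let e : G.induce C ≃g G'.induce (φ '' C) :=
    ⟨Equiv.Set.image φ C φ.injective, by simp⟩
  have hnbr : ∀ v, {u | u ∈ φ '' C ∧ G'.Adj (φ v) u} = φ '' {u | u ∈ C ∧ G.Adj v u} := by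
    intro v
    ext u
    constructor
    · rintro ⟨⟨x, hx, rfl⟩, h⟩
      exact ⟨x, ⟨hx, φ.map_adj_iff.1 h⟩, rfl⟩
    · rintro ⟨x, ⟨hx, h⟩, rfl⟩
      exact ⟨⟨x, hx, rfl⟩, φ.map_adj_iff.2 h⟩
  simp only [IsCycleSet, Set.ncard_image_of_injective _ φ.injective, ← e.connected_iff,
    Set.forall_mem_image, hnbr]

theorem isCycleSet_triangle {a b c : V} (hab : G.Adj a b) (hac : G.Adj a c) (hbc : G.Adj b c) :
    IsCycleSet G {a, b, c} := by
  refine ⟨?_, ?_, ?_⟩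
  · rw [Set.ncard_eq_three.2 ⟨a, b, c, hab.ne, hac.ne, hbc.ne, rfl⟩]
  · rw [SimpleGraph.connected_iff_exists_forall_reachable]
    refine ⟨⟨a, by simp⟩, ?_⟩
    rintro ⟨x, rfl | rfl | rfl⟩
    · exact SimpleGraph.Reachable.refl _
    · exact SimpleGraph.Adj.reachable (by simpa using hab)
    · exact SimpleGraph.Adj.reachable (by simpa using hac)
  · rintro v (rfl | rfl | rfl)
    · rw [show {u | u ∈ ({v, b, c} : Set V) ∧ G.Adj v u} = {b, c} by
        ext u; have := G.loopless.irrefl v; simp; grind]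
      exact Set.ncard_pair hbc.ne
    · rw [show {u | u ∈ ({a, v, c} : Set V) ∧ G.Adj v u} = {a, c} by
        ext u; have := G.loopless.irrefl v; have := hab.symm; simp; grind]
      exact Set.ncard_pair hac.ne
    · rw [show {u | u ∈ ({a, b, v} : Set V) ∧ G.Adj v u} = {a, b} by
        ext u; have := G.loopless.irrefl v; have := hac.symm; have := hbc.symm; simp; grind]
      exact Set.ncard_pair hab.ne

theorem IsCycleSet.nonempty {C : Set V} (h : IsCycleSet G C) : C.Nonempty :=
  Set.nonempty_coe_sort.1 h.2.1.nonempty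

theorem IsCycleSet.exists_adj_boundary {C M : Set V} (h : IsCycleSet G C)
    (hCM : (C ∩ M).Nonempty) (hC : ¬ C ⊆ M) : ∃ u ∈ C ∩ M, ∃ v ∈ C \ M, G.Adj u v := by
  obtain ⟨x, hxC, hxM⟩ := hCM
  obtain ⟨y, hyC, hyM⟩ := Set.not_subset.1 hC
  obtain ⟨p⟩ := h.2.1.preconnected ⟨x, hxC⟩ ⟨y, hyC⟩
  obtain ⟨d, -, h₁, h₂⟩ := p.exists_boundary_dart (Subtype.val ⁻¹' M) hxM hyM
  exact ⟨d.fst, ⟨d.fst.2, h₁⟩, d.snd, ⟨d.snd.2, h₂⟩, d.adj⟩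

section Finite

variable [Finite V]

theorem bddAbove_isIndepCyclePacking :
    BddAbove {k | ∃ f : Fin k → Set V, IsIndepCyclePacking G k f} := by
  refine ⟨Nat.card V, ?_⟩
  rintro k ⟨f, hf, hd⟩
  choose x hx using fun i => (hf i).nonempty
  have hinj : Function.Injective x := by
    intro i j hij
    by_contra hne
    exact (hd i j hne _ (hx i) _ (hx j)).1 hij
  simpa using Nat.card_le_card_of_injective x hinj

variable (G) in
theorem exists_isIndepCyclePacking_icpNum :
    ∃ f : Fin (icpNum G) → Set V, IsIndepCyclePacking G (icpNum G) f :=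
  Nat.sSup_mem (s := {k | ∃ f : Fin k → Set V, IsIndepCyclePacking G k f})
    ⟨0, fun i => i.elim0, fun i => i.elim0, fun i => i.elim0⟩ bddAbove_isIndepCyclePacking

theorem card_le_icpNum {ι : Type*} [Finite ι] (f : ι → Set V) (hf : ∀ i, IsCycleSet G (f i))
    (hd : ∀ i j, i ≠ j → ∀ u ∈ f i, ∀ v ∈ f j, u ≠ v ∧ ¬ G.Adj u v) :
    Nat.card ι ≤ icpNum G := by
  let e := (Finite.equivFin ι).symm
  exact le_csSup bddAbove_isIndepCyclePacking
    ⟨f ∘ e, fun i => hf _, fun i j hij => hd _ _ (e.injective.ne hij)⟩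

end Finite

theorem icpNum_le_of_embedding [Finite V] [Finite V'] (φ : G ↪g G') : icpNum G ≤ icpNum G' := by
  obtain ⟨f, hf, hd⟩ := exists_isIndepCyclePacking_icpNum G
  have := card_le_icpNum (G := G') (fun i => φ '' f i) (fun i => (isCycleSet_image_iff φ).2 (hf i))
    (by
      rintro i j hij _ ⟨u, hu, rfl⟩ _ ⟨v, hv, rfl⟩
      simpa [φ.injective.eq_iff] using hd i j hij u hu v hv)
  simpa using this

theorem IsCycleSet.preimage_val {p : V → Prop} {C : Set V} (h : IsCycleSet G C)
    (hC : ∀ v ∈ C, p v) :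
    IsCycleSet (G.comap (Subtype.val : Subtype p → V)) (Subtype.val ⁻¹' C) := by
  let φ : G.comap (Subtype.val : Subtype p → V) ↪g G :=
    ⟨⟨Subtype.val, Subtype.val_injective⟩, Iff.rfl⟩
  rw [← isCycleSet_image_iff φ]
  have : φ '' (Subtype.val ⁻¹' C) = C :=
    Subtype.image_preimage_val _ _ |>.trans (Set.inter_eq_right.2 hC)
  rwa [this]

theorem card_le_icpNum_induce [Finite V] {ι : Type*} [Finite ι] {M : Set V} (f : ι → Set V)
    (hf : ∀ i, IsCycleSet G (f i))
    (hd : ∀ i j, i ≠ j → ∀ u ∈ f i, ∀ v ∈ f j, u ≠ v ∧ ¬ G.Adj u v) (hM : ∀ i, f i ⊆ M) :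
    Nat.card ι ≤ icpNum (G.induce M) :=
  card_le_icpNum (fun i => Subtype.val ⁻¹' f i) (fun i => (hf i).preimage_val (hM i))
    fun i j hij u hu v hv => by
      simpa [Subtype.ext_iff] using hd i j hij u.1 hu v.1 hv

end CyclePacking

section Replacement

variable {V W : Type*} {G : SimpleGraph V} {M : Set V} {H : SimpleGraph W}

theorem IsCycleSet.image_inl {C : Set V} (h : IsCycleSet G C) (hC : ∀ v ∈ C, v ∉ M) :
    IsCycleSet (modularReplacement G M H) (Sum.inl '' (Subtype.val ⁻¹' C)) :=
  (isCycleSet_image_iff (modularReplacement.inlEmbedding G M H)).2 (h.preimage_val hC)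

theorem IsCycleSet.image_inr {C : Set W} (h : IsCycleSet H C) :
    IsCycleSet (modularReplacement G M H) (Sum.inr '' C) :=
  (isCycleSet_image_iff (modularReplacement.inrEmbedding G M H)).2 h

variable [Finite V] [Finite W]

/-- If some cycle of the packing crosses the boundary of the module, it can be exchanged for a
triangle consisting of one of its vertices and an edge of the replacing graph. -/
theorem card_le_icpNum_modularReplacement_of_crossing {ι : Type*} [Finite ι] {f : ι → Set V}
    (hMod : G.IsModuleSet M) (hf : ∀ i, IsCycleSet G (f i))
    (hd : ∀ i j, i ≠ j → ∀ u ∈ f i, ∀ v ∈ f j, u ≠ v ∧ ¬ G.Adj u v) {a b : W} (hab : H.Adj a b)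
    {i₀ : ι} (hM : (f i₀ ∩ M).Nonempty) (hi₀ : ¬ f i₀ ⊆ M) :
    Nat.card ι ≤ icpNum (modularReplacement G M H) := by
  classical
  obtain ⟨m, ⟨hmC, hmM⟩, v, ⟨hvC, hvM⟩, hmv⟩ := (hf i₀).exists_adj_boundary hM hi₀
  have hv : ∀ x ∈ M, G.Adj v x := (hMod v hvM).resolve_right fun h => h m hmM hmv.symm
  have hdisj : ∀ i ≠ i₀, ∀ x ∈ f i, x ∉ M := fun i hi x hx hxM =>
    (hd i i₀ hi x hx v hvC).2 (hv x hxM).symm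
  have hnbr : ∀ i ≠ i₀, ∀ x ∈ f i, ∀ y ∈ M, ¬ G.Adj x y := fun i hi x hx y hy hxy =>
    (hd i i₀ hi x hx m hmC).2
      ((hMod x (hdisj i hi x hx)).resolve_right (fun h => h y hy hxy) m hmM)
  let T : Set ({v : V // v ∉ M} ⊕ W) := {Sum.inl ⟨v, hvM⟩, Sum.inr a, Sum.inr b}
  have hT : ∀ i ≠ i₀, ∀ x ∈ Sum.inl '' (Subtype.val ⁻¹' f i), ∀ y ∈ T,
      x ≠ y ∧ ¬ (modularReplacement G M H).Adj x y := by
    rintro i hi _ ⟨x, hx, rfl⟩ y (rfl | rfl | rfl)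
    · simpa [Subtype.ext_iff] using hd i i₀ hi x.1 hx v hvC
    · simpa using hnbr i hi x.1 hx
    · simpa using hnbr i hi x.1 hx
  refine card_le_icpNum (fun i => if i = i₀ then T else Sum.inl '' (Subtype.val ⁻¹' f i)) ?_ ?_
  · intro i
    by_cases hi : i = i₀
    · simp only [hi, if_true]
      exact isCycleSet_triangle (by simpa using ⟨m, hmM, hmv.symm⟩)
        (by simpa using ⟨m, hmM, hmv.symm⟩) (by simpa using hab)
    · simp only [hi, if_false]
      exact (hf i).image_inl (hdisj i hi)
  · intro i j hij x hx y hy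
    by_cases hi : i = i₀ <;> by_cases hj : j = i₀ <;>
      simp only [hi, hj, if_true, if_false] at hx hy
    · exact absurd (hi.trans hj.symm) hij
    · obtain ⟨h₁, h₂⟩ := hT j hj y hy x hx
      exact ⟨h₁.symm, fun h => h₂ h.symm⟩
    · exact hT i hi x hx y hy
    · obtain ⟨x, hx, rfl⟩ := hx
      obtain ⟨y, hy, rfl⟩ := hy
      simpa [Subtype.ext_iff] using hd i j hij x.1 hx y.1 hy

/-- If no cycle of the packing crosses the boundary of the module, the cycles inside the module
can be exchanged for a maximum packing of the replacing graph. -/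
theorem card_le_icpNum_modularReplacement_of_not_crossing {ι : Type*} [Finite ι] {f : ι → Set V}
    (hMod : G.IsModuleSet M) (hf : ∀ i, IsCycleSet G (f i))
    (hd : ∀ i j, i ≠ j → ∀ u ∈ f i, ∀ v ∈ f j, u ≠ v ∧ ¬ G.Adj u v)
    (hicp : icpNum (G.induce M) ≤ icpNum H) (hM : ∀ i, (f i ∩ M).Nonempty → f i ⊆ M) :
    Nat.card ι ≤ icpNum (modularReplacement G M H) := by
  classical
  have hout : ∀ i, ¬ f i ⊆ M → ∀ x ∈ f i, x ∉ M := fun i hi x hx hxM => hi (hM i ⟨x, hx, hxM⟩)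
  by_cases hin : ∃ i, f i ⊆ M
  · obtain ⟨i₀, hi₀⟩ := hin
    obtain ⟨m, hm⟩ := (hf i₀).nonempty
    have hnbr : ∀ i, ¬ f i ⊆ M → ∀ x ∈ f i, ∀ y ∈ M, ¬ G.Adj x y := fun i hi x hx y hy hxy =>
      (hd i i₀ (fun h => hi (h ▸ hi₀)) x hx m hm).2
        ((hMod x (hout i hi x hx)).resolve_right (fun h => h y hy hxy) m (hi₀ hm))
    obtain ⟨g, hg, hgd⟩ := exists_isIndepCyclePacking_icpNum H
    have hA : Nat.card {i // f i ⊆ M} ≤ icpNum H :=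
      (card_le_icpNum_induce (fun i : {i // f i ⊆ M} => f i) (fun i => hf i)
        (fun i j hij => hd i j (Subtype.val_injective.ne hij)) fun i => i.2).trans hicp
    have hB : Nat.card (Fin (icpNum H) ⊕ {i // ¬ f i ⊆ M}) ≤
        icpNum (modularReplacement G M H) := by
      refine card_le_icpNum
        (Sum.elim (fun i => Sum.inr '' g i) fun i => Sum.inl '' (Subtype.val ⁻¹' f i)) ?_ ?_
      · rintro (i | ⟨i, hi⟩)
        · exact (hg i).image_inr
        · exact (hf i).image_inl (hout i hi)
      · rintro (i | ⟨i, hi⟩) (j | ⟨j, hj⟩) hij _ ⟨x, hx, rfl⟩ _ ⟨y, hy, rfl⟩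
        · simpa using hgd i j (by simpa using hij) x hx y hy
        · simpa using hnbr j hj y.1 hy
        · simpa using hnbr i hi x.1 hx
        · simpa [Subtype.ext_iff] using hd i j (by simpa using hij) x.1 hx y.1 hy
    have hsum : Nat.card ι = Nat.card {i // f i ⊆ M} + Nat.card {i // ¬ f i ⊆ M} := by
      rw [← Nat.card_sum, Nat.card_congr (Equiv.sumCompl fun i => f i ⊆ M)]
    rw [Nat.card_sum, Nat.card_fin] at hB
    omega
  · push Not at hin
    refine card_le_icpNum (fun i => Sum.inl '' (Subtype.val ⁻¹' f i))
      (fun i => (hf i).image_inl (hout i (hin i))) ?_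
    rintro i j hij _ ⟨x, hx, rfl⟩ _ ⟨y, hy, rfl⟩
    simpa [Subtype.ext_iff] using hd i j hij x.1 hx y.1 hy

end Replacement

theorem stmt19 {V W : Type*} [Fintype V] [Fintype W]
    (G : SimpleGraph V) (H : SimpleGraph W) (M : Set V)
    (hG : G.Connected) (hH : H.Connected)
    (hMod : G.IsModuleSet M) (hne : M.Nonempty) (hproper : M ≠ Set.univ)
    (hcard : M.ncard = Fintype.card W)
    (hvc : vcNum (G.induce M) = vcNum H)
    (him : imNum (G.induce M) = imNum H)
    (hicp : icpNum (G.induce M) = icpNum H) :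
    icpNum G ≤ icpNum (modularReplacement G M H) := by
  rcases subsingleton_or_nontrivial W with hW | hW
  · obtain ⟨w⟩ := hH.nonempty
    have hM : M.Subsingleton := by
      rw [← Set.encard_le_one_iff_subsingleton, ← M.toFinite.cast_ncard_eq, hcard]
      exact_mod_cast Fintype.card_le_one_iff_subsingleton.2 hW
    exact icpNum_le_of_embedding (modularReplacement.embeddingOfSubsingleton G M H hM w)
  · obtain ⟨a⟩ := hH.nonempty
    obtain ⟨b, hab⟩ := hH.preconnected.exists_adj_of_nontrivial a
    obtain ⟨f, hf, hd⟩ := exists_isIndepCyclePacking_icpNum G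
    rw [← Nat.card_fin (icpNum G)]
    by_cases hcross : ∃ i, (f i ∩ M).Nonempty ∧ ¬ f i ⊆ M
    · obtain ⟨i₀, hM, hi₀⟩ := hcross
      exact card_le_icpNum_modularReplacement_of_crossing hMod hf hd hab hM hi₀
    · push Not at hcross
      exact card_le_icpNum_modularReplacement_of_not_crossing hMod hf hd hicp.le hcross
end
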